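/- arXiv:2601.08407 — 2 statements merged into one kernel-verified Lean document; each statement's English description precedes it below -/
import Mathlib

section
/- Let X be a compact metric space and f : X → X a continuous map. If x is both a shadowable point for f and an upper semicontinuity point of the ω-limit set map ω_f, then ω_f(x) = Ω_f(x). -/
open Filter Topology

variable {X : Type*} [MetricSpace X]

/-- The ω-limit set of `x` under `f`: points `y` with `f^[φ j] x → y` for some
strictly increasing sequence `φ`. -/
def omegaLimitPt (f : X → X) (x : X) : Set X :=
  {y | ∃ φ : ℕ → ℕ, StrictMono φ ∧ Tendsto (fun j => f^[φ j] x) atTop (𝓝 y)}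

/-- The set `Ω_f(x)`: points `y` such that there are `x_j → x` and a strictly
increasing sequence `φ` with `f^[φ j] (x_j) → y`. -/
def bigOmega (f : X → X) (x : X) : Set X :=
  {y | ∃ (xs : ℕ → X) (φ : ℕ → ℕ), StrictMono φ ∧
    Tendsto xs atTop (𝓝 x) ∧ Tendsto (fun j => f^[φ j] (xs j)) atTop (𝓝 y)}

/-- `x` is a shadowable point for `f`. -/
def ShadowablePoint (f : X → X) (x : X) : Prop :=
  ∀ ε > 0, ∃ δ > 0, ∀ xs : ℕ → X, (∀ i, dist (f (xs i)) (xs (i + 1)) ≤ δ) →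
    xs 0 = x → ∃ y, ∀ i, dist (xs i) (f^[i] y) ≤ ε

/-- `x` is an upper semicontinuity point of the ω-limit set map. -/
def USCPoint (f : X → X) (x : X) : Prop :=
  ∀ U : Set X, IsOpen U → omegaLimitPt f x ⊆ U →
    ∃ δ > 0, ∀ y, dist x y ≤ δ → omegaLimitPt f y ⊆ U

/-- `x` is a lower semicontinuity point of the ω-limit set map. -/
def LSCPoint (f : X → X) (x : X) : Prop :=
  ∀ U : Set X, IsOpen U → (omegaLimitPt f x ∩ U).Nonempty →
    ∃ δ > 0, ∀ y, dist x y ≤ δ → (omegaLimitPt f y ∩ U).Nonempty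

/-- `(c i)_{i=0}^k` is a `δ`-chain of `f` (with `k ≥ 1`). -/
def IsDeltaChain (f : X → X) (δ : ℝ) (c : ℕ → X) (k : ℕ) : Prop :=
  1 ≤ k ∧ ∀ i < k, dist (f (c i)) (c (i + 1)) ≤ δ

/-- `y → z`: for every `δ > 0` there is a `δ`-chain of `f` from `y` to `z`. -/
def ChainReach (f : X → X) (y z : X) : Prop :=
  ∀ δ > 0, ∃ (c : ℕ → X) (k : ℕ), IsDeltaChain f δ c k ∧ c 0 = y ∧ c k = z

/-- A set `S` is chain stable: `y ∈ S` and `y → z` imply `z ∈ S`. -/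
def ChainStable (f : X → X) (S : Set X) : Prop :=
  ∀ y ∈ S, ∀ z, ChainReach f y z → z ∈ S

/-- The set `ω_f*(x)`: points reachable from `x` by arbitrarily fine and
arbitrarily long `δ`-chains. -/
def omegaStar (f : X → X) (x : X) : Set X :=
  {y | ∀ δ > 0, ∀ l : ℕ, 1 ≤ l → ∃ (c : ℕ → X) (k : ℕ),
    l ≤ k ∧ IsDeltaChain f δ c k ∧ c 0 = x ∧ c k = y}

/-- The chain component of a point `p`. -/
def chainComponent (f : X → X) (p : X) : Set X :=
  {q | ChainReach f p q ∧ ChainReach f q p}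

/-- `f` is chain continuous at `x`. -/
def ChainContinuousAt (f : X → X) (x : X) : Prop :=
  ∀ ε > 0, ∃ δ > 0, ∀ xs : ℕ → X, (∀ i, dist (f (xs i)) (xs (i + 1)) ≤ δ) →
    xs 0 = x → ∀ i, dist (xs i) (f^[i] x) ≤ ε

/-- The chain recurrent set `CR(f)`. -/
def chainRecurrent (f : X → X) : Set X := {x | ChainReach f x x}

/-- `x` is a regularly recurrent point for `f`. -/
def RegularlyRecurrent (f : X → X) (x : X) : Prop :=
  ∀ ε > 0, ∃ k : ℕ, 1 ≤ k ∧ ∀ j : ℕ, dist x (f^[j * k] x) ≤ ε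

/-- `M` is a minimal set for `f`. -/
def IsMinimalSet (f : X → X) (M : Set X) : Prop :=
  M.Nonempty ∧ IsClosed M ∧ f '' M ⊆ M ∧ ∀ y ∈ M, omegaLimitPt f y = M

theorem mem_omegaLimitPt_iff (f : X → X) (x y : X) :
    y ∈ omegaLimitPt f x ↔ ∀ ε > 0, ∀ N : ℕ, ∃ n ≥ N, dist (f^[n] x) y < ε := by
  constructor
  · rintro ⟨φ, hφ, hlim⟩ ε hε N
    obtain ⟨k, hk, hkN⟩ :=
      ((Metric.tendsto_nhds.1 hlim ε hε).and (eventually_ge_atTop N)).exists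
    exact ⟨φ k, hkN.trans hφ.le_apply, hk⟩
  · intro h
    have hc : MapClusterPt y atTop (fun n => f^[n] x) := by
      rw [Metric.nhds_basis_ball.mapClusterPt_iff_frequently]
      exact fun ε hε => frequently_atTop.2 (h ε hε)
    exact hc.tendsto_subseq

/-- In a compact space, an orbit that visits a closed set infinitely often has an ω-limit point
in that set. -/
theorem exists_mem_omegaLimitPt_of_frequently [CompactSpace X] (f : X → X) (x : X) {S : Set X}
    (hS : IsClosed S) (h : ∃ᶠ n in atTop, f^[n] x ∈ S) : ∃ q ∈ S, q ∈ omegaLimitPt f x := by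
  obtain ⟨φ, hφ, hφS⟩ := extraction_of_frequently_atTop h
  obtain ⟨q, hq, ψ, hψ, hlim⟩ := hS.isCompact.tendsto_subseq hφS
  exact ⟨q, hq, φ ∘ ψ, hφ.comp hψ, hlim⟩

theorem omegaLimitPt_subset_bigOmega (f : X → X) (x : X) : omegaLimitPt f x ⊆ bigOmega f x :=
  fun _ ⟨φ, hφ, hlim⟩ => ⟨fun _ => x, φ, hφ, tendsto_const_nhds, hlim⟩

/-- `StepsTo R B n a`: some `R`-path of length `n` leads from `a` into `B`. -/
def StepsTo {α : Type*} (R : α → α → Prop) (B : Set α) : ℕ → α → Prop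
  | 0, a => a ∈ B
  | n + 1, a => ∃ b, R a b ∧ StepsTo R B n b

theorem exists_stepsTo_of_reflTransGen {α : Type*} {R : α → α → Prop} {B : Set α} {a b : α}
    (hb : b ∈ B) (h : Relation.ReflTransGen R a b) : ∃ n, StepsTo R B n a := by
  induction h using Relation.ReflTransGen.head_induction_on with
  | refl => exact ⟨0, hb⟩
  | head hac _ ih =>
    obtain ⟨n, hn⟩ := ih
    exact ⟨n + 1, _, hac, hn⟩

/-- If every point of `B` has a nontrivial `R`-path back into `B`, then from any point leading
into `B` there is an infinite `R`-path visiting `B` infinitely often. -/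
theorem exists_path_frequently_mem {α : Type*} {R : α → α → Prop} {B : Set α}
    (hB : ∀ b ∈ B, ∃ b' ∈ B, Relation.TransGen R b b') {x b₀ : α} (hb₀ : b₀ ∈ B)
    (hx : Relation.ReflTransGen R x b₀) :
    ∃ u : ℕ → α, u 0 = x ∧ (∀ i, R (u i) (u (i + 1))) ∧ ∃ᶠ n in atTop, u n ∈ B := by
  have hnext : ∀ s : {p : ℕ × α // StepsTo R B p.1 p.2}, ∃ t : {p : ℕ × α // StepsTo R B p.1 p.2},
      R s.1.2 t.1.2 ∧ ∀ n, s.1.1 = n + 1 → t.1.1 = n := by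
    rintro ⟨⟨n, a⟩, ha⟩
    cases n with
    | zero =>
      obtain ⟨b', hb', hab⟩ := hB a ha
      obtain ⟨c, hac, hcb⟩ := Relation.TransGen.head'_iff.1 hab
      obtain ⟨m, hm⟩ := exists_stepsTo_of_reflTransGen hb' hcb
      exact ⟨⟨(m, c), hm⟩, hac, fun n hn => by simp at hn⟩
    | succ n =>
      obtain ⟨c, hac, hc⟩ := ha
      exact ⟨⟨(n, c), hc⟩, hac, fun m hm => by simpa using hm⟩
  choose next hR hdec using hnext
  obtain ⟨n₀, hn₀⟩ := exists_stepsTo_of_reflTransGen hb₀ hx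
  set s : ℕ → {p : ℕ × α // StepsTo R B p.1 p.2} := fun i => next^[i] ⟨(n₀, x), hn₀⟩ with hs
  have hsucc : ∀ i, s (i + 1) = next (s i) := fun i => Function.iterate_succ_apply' _ _ _
  have hvisit : ∀ n i, (s i).1.1 = n → ∃ m ≥ i, (s m).1.2 ∈ B := by
    intro n
    induction n with
    | zero =>
      intro i hi
      have h := (s i).2
      rw [hi] at h
      exact ⟨i, le_rfl, h⟩
    | succ n ih =>
      intro i hi
      obtain ⟨m, hm, hmB⟩ := ih (i + 1) (by rw [hsucc]; exact hdec _ n hi)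
      exact ⟨m, by omega, hmB⟩
  refine ⟨fun i => (s i).1.2, rfl, fun i => ?_, frequently_atTop.2 fun i => hvisit _ i rfl⟩
  simp only [hsucc]
  exact hR _

theorem reflTransGen_iterate {f : X → X} {δ : ℝ} (hδ : 0 ≤ δ) (x : X) {m n : ℕ} (h : m ≤ n) :
    Relation.ReflTransGen (fun a b => dist (f a) b ≤ δ) (f^[m] x) (f^[n] x) := by
  induction n, h using Nat.le_induction with
  | base => exact .refl
  | succ n _ ih => exact ih.tail (by simpa [Function.iterate_succ_apply'] using hδ)

/-- A fine pseudo orbit through points near `y ∈ Ω_f(x)` can leave the orbit of `x` at any time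
and return to it later. -/
theorem exists_chain_near_of_mem_bigOmega [CompactSpace X] {f : X → X} (hf : Continuous f)
    {x y : X} (husc : USCPoint f x) (hy : y ∈ bigOmega f x) {δ ε : ℝ} (hδ : 0 < δ) (hε : 0 < ε)
    (M : ℕ) : ∃ b, dist b y ≤ ε ∧ Relation.TransGen (fun a b => dist (f a) b ≤ δ) (f^[M] x) b ∧
      ∃ M', Relation.ReflTransGen (fun a b => dist (f a) b ≤ δ) b (f^[M'] x) := by
  obtain ⟨xs, φ, hφ, hxs, hlim⟩ := hy
  obtain ⟨η, hη, hU⟩ := husc (Metric.thickening (δ / 2) (omegaLimitPt f x))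
    Metric.isOpen_thickening (Metric.self_subset_thickening (by positivity) _)
  have hM := ((hf.iterate (M + 1)).tendsto x).comp hxs
  obtain ⟨j, hjM, hjy, hjx, hj⟩ := ((Metric.tendsto_nhds.1 hM δ hδ).and
    ((Metric.tendsto_nhds.1 hlim ε hε).and
      ((Metric.tendsto_nhds.1 hxs η hη).and (eventually_ge_atTop (M + 1))))).exists
  have hφj : M + 1 ≤ φ j := hj.trans hφ.le_apply
  refine ⟨f^[φ j] (xs j), hjy.le, ?_, ?_⟩
  · refine Relation.TransGen.trans_left (.single ?_) (reflTransGen_iterate hδ.le (xs j) hφj)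
    rw [← Function.iterate_succ_apply' f, dist_comm]
    exact hjM.le
  · obtain ⟨q, -, hq⟩ := exists_mem_omegaLimitPt_of_frequently f (xs j) isClosed_univ
      (Frequently.of_forall fun _ => Set.mem_univ _)
    obtain ⟨p, hp, hqp⟩ := Metric.mem_thickening_iff.1
      (hU (xs j) (by rw [dist_comm]; exact hjx.le) hq)
    obtain ⟨k, hk, hkq⟩ := (mem_omegaLimitPt_iff f (xs j) q).1 hq (δ / 4) (by positivity) (φ j + 1)
    obtain ⟨M', -, hM'⟩ := (mem_omegaLimitPt_iff f x p).1 hp (δ / 4) (by positivity) 0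
    obtain ⟨k, rfl⟩ : ∃ l, k = l + 1 := ⟨k - 1, by omega⟩
    refine ⟨M', (reflTransGen_iterate hδ.le (xs j) (by omega : φ j ≤ k)).tail ?_⟩
    rw [← Function.iterate_succ_apply' f]
    have h₁ := dist_triangle4 (f^[k + 1] (xs j)) q p (f^[M'] x)
    rw [dist_comm p] at h₁
    linarith

theorem stmt2 [CompactSpace X] (f : X → X) (hf : Continuous f) (x : X)
    (hsh : ShadowablePoint f x) (husc : USCPoint f x) :
    omegaLimitPt f x = bigOmega f x := by
  refine (omegaLimitPt_subset_bigOmega f x).antisymm fun y hy => ?_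
  rw [mem_omegaLimitPt_iff]
  intro r hr N
  obtain ⟨η, hη, hU⟩ := husc (Metric.thickening (r / 4) (omegaLimitPt f x))
    Metric.isOpen_thickening (Metric.self_subset_thickening (by positivity) _)
  set ε := min η (r / 8)
  have hε : 0 < ε := lt_min hη (by positivity)
  have hεη : ε ≤ η := min_le_left _ _
  have hεr : ε ≤ r / 8 := min_le_right _ _
  obtain ⟨δ, hδ, hshadow⟩ := hsh ε hε
  have hchain := exists_chain_near_of_mem_bigOmega hf husc hy hδ hε
  set R : X → X → Prop := fun a b => dist (f a) b ≤ δ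
  obtain ⟨b₀, hb₀y, hxb₀, hb₀⟩ := hchain 0
  obtain ⟨u, hu0, huR, huB⟩ := exists_path_frequently_mem (R := R)
    (B := {b | dist b y ≤ ε ∧ ∃ M, Relation.ReflTransGen R b (f^[M] x)})
    (by
      rintro b ⟨-, M, hM⟩
      obtain ⟨b', hb'y, hxb', hb'⟩ := hchain M
      exact ⟨b', ⟨hb'y, hb'⟩, Relation.TransGen.trans_right hM hxb'⟩)
    ⟨hb₀y, hb₀⟩ hxb₀.to_reflTransGen
  obtain ⟨z, hz⟩ := hshadow u huR hu0
  have hxz : dist x z ≤ η := by simpa [hu0] using (hz 0).trans hεη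
  obtain ⟨q, hqy, hq⟩ := exists_mem_omegaLimitPt_of_frequently f z
    (Metric.isClosed_closedBall (x := y) (ε := 2 * ε)) (huB.mono fun n hn => by
      have h₁ := dist_triangle_left (f^[n] z) y (u n)
      have h₂ := hz n
      have h₃ := hn.1
      rw [Metric.mem_closedBall]
      linarith)
  obtain ⟨p, hp, hqp⟩ := Metric.mem_thickening_iff.1 (hU z hxz hq)
  obtain ⟨n, hn, hnp⟩ := (mem_omegaLimitPt_iff f x p).1 hp (r / 4) (by positivity) N
  refine ⟨n, hn, ?_⟩
  have h₁ := dist_triangle4 (f^[n] x) p q y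
  rw [dist_comm p] at h₁
  rw [Metric.mem_closedBall] at hqy
  linarith
end

section
/- Let X be a compact metric space and f : X → X a continuous map. For every shadowable point x of f, the following are equivalent: (i) x is an upper semicontinuity point of the ω-limit set map ω_f; (ii) ω_f(x) is chain stable. -/
open Filter Topology

variable {X : Type*} [MetricSpace X]

lemma mem_omegaLimitPt_iff_mapClusterPt {f : X → X} {x y : X} :
    y ∈ omegaLimitPt f x ↔ MapClusterPt y atTop (fun n => f^[n] x) := by
  constructor
  · rintro ⟨φ, hφ, h⟩
    exact MapClusterPt.of_comp hφ.tendsto_atTop h.mapClusterPt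
  · intro h
    exact MapClusterPt.tendsto_subseq h

lemma isClosed_omegaLimitPt (f : X → X) (x : X) : IsClosed (omegaLimitPt f x) := by
  have h : omegaLimitPt f x = {y | ClusterPt y (map (fun n => f^[n] x) atTop)} := by
    ext y
    exact mem_omegaLimitPt_iff_mapClusterPt
  rw [h]
  exact isClosed_setOfPred_clusterPt

lemma omegaLimitPt_nonempty [CompactSpace X] (f : X → X) (x : X) :
    (omegaLimitPt f x).Nonempty := by
  obtain ⟨y, hy⟩ := exists_clusterPt_of_compactSpace (map (fun n => f^[n] x) atTop)
  exact ⟨y, mem_omegaLimitPt_iff_mapClusterPt.2 hy⟩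

lemma exists_ge_iterate_mem_of_mem_omegaLimitPt {f : X → X} {x y : X}
    (hy : y ∈ omegaLimitPt f x) {s : Set X} (hs : s ∈ 𝓝 y) (N : ℕ) :
    ∃ n ≥ N, f^[n] x ∈ s :=
  frequently_atTop.1 ((mem_omegaLimitPt_iff_mapClusterPt.1 hy).frequently hs) N

/-- A `δ`-chain that jumps from `f y` to `p`, follows the orbit of `p`, and finally jumps to `q`. -/
lemma exists_isDeltaChain_of_orbit {f : X → X} {δ : ℝ} (hδ : 0 ≤ δ) {y p q : X} {m : ℕ}
    (hp : dist (f y) p ≤ δ) (hq : dist (f^[m + 1] p) q ≤ δ) :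
    ∃ (c : ℕ → X) (k : ℕ), IsDeltaChain f δ c k ∧ c 0 = y ∧ c k = q := by
  refine ⟨fun i => if i = 0 then y else if i ≤ m + 1 then f^[i - 1] p else q, m + 2,
    ⟨by omega, fun i hi => ?_⟩, by simp, by simp⟩
  rcases Nat.eq_zero_or_pos i with rfl | hi0
  · simpa using hp
  · obtain ⟨j, rfl⟩ := Nat.exists_eq_add_of_lt hi0
    rcases Nat.lt_or_ge j m with hj | hj
    · simp [show j + 1 ≤ m + 1 by omega, show j + 1 + 1 ≤ m + 1 by omega,
        ← Function.iterate_succ_apply', hδ]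
    · obtain rfl : j = m := by omega
      simpa [← Function.iterate_succ_apply'] using hq

lemma ChainReach.trans {f : X → X} {a b c : X} (hab : ChainReach f a b)
    (hbc : ChainReach f b c) : ChainReach f a c := by
  intro δ hδ
  obtain ⟨u, k, ⟨hk, hu⟩, hu0, huk⟩ := hab δ hδ
  obtain ⟨v, l, ⟨hl, hv⟩, hv0, hvl⟩ := hbc δ hδ
  refine ⟨fun i => if i < k then u i else v (i - k), k + l, ⟨by omega, fun i hi => ?_⟩,
    by simp [show 0 < k by omega, hu0], by simp [hvl]⟩
  rcases lt_trichotomy (i + 1) k with h | h | h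
  · simpa [h, show i < k by omega] using hu i (by omega)
  · have := hu i (by omega)
    rw [h, huk, ← hv0] at this
    simpa [h, show i < k by omega] using this
  · have := hv (i - k) (by omega)
    rw [show i - k + 1 = i + 1 - k by omega] at this
    simpa [show ¬ i < k by omega, show ¬ i + 1 < k by omega] using this

lemma chainReach_of_mem_omegaLimitPt {f : X → X} {x q : X} (hq : q ∈ omegaLimitPt f x) :
    ChainReach f x q := by
  intro δ hδ
  obtain ⟨n, hn, h⟩ :=
    exists_ge_iterate_mem_of_mem_omegaLimitPt hq (Metric.closedBall_mem_nhds q hδ) 2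
  obtain ⟨m, rfl⟩ := Nat.exists_eq_add_of_le' hn
  exact exists_isDeltaChain_of_orbit hδ.le (p := f x) (by simpa using hδ.le) h

/-- If `y` is an ω-limit point of `x` and `q` is a limit of ω-limit points of points converging
to `x`, then `y → q`. -/
lemma chainReach_of_tendsto_omegaLimitPt {f : X → X} (hf : Continuous f) {x y q : X}
    (hy : y ∈ omegaLimitPt f x) {xs qs : ℕ → X} (hxs : Tendsto xs atTop (𝓝 x))
    (hqs : Tendsto qs atTop (𝓝 q)) (h : ∀ j, qs j ∈ omegaLimitPt f (xs j)) :
    ChainReach f y q := by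
  intro δ hδ
  have hnear : {p | dist (f y) (f p) < δ} ∈ 𝓝 y :=
    (isOpen_lt (by fun_prop) continuous_const).mem_nhds (by simpa using hδ)
  obtain ⟨n, -, hn⟩ := exists_ge_iterate_mem_of_mem_omegaLimitPt hy hnear 0
  have hn' : dist (f y) (f^[n + 1] x) < δ := by
    rw [Function.iterate_succ_apply']
    exact hn
  have hx : ∀ᶠ j in atTop, dist (f y) (f^[n + 1] (xs j)) < δ :=
    (tendsto_const_nhds.dist (((hf.iterate (n + 1)).tendsto x).comp hxs)).eventually_lt_const hn'
  have hq : ∀ᶠ j in atTop, qs j ∈ Metric.ball q δ := hqs (Metric.ball_mem_nhds q hδ)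
  obtain ⟨j, hjx, hjq⟩ := (hx.and hq).exists
  obtain ⟨l, hl, hlq⟩ := exists_ge_iterate_mem_of_mem_omegaLimitPt (h j)
    (Metric.isOpen_ball.mem_nhds hjq) (n + 2)
  obtain ⟨m, rfl⟩ := Nat.exists_eq_add_of_le' hl
  refine exists_isDeltaChain_of_orbit hδ.le hjx.le (m := m) ?_
  rw [← Function.iterate_add_apply, show m + 1 + (n + 1) = m + (n + 2) by omega]
  exact (Metric.mem_ball.1 hlq).le

lemma chainReach_of_mem_omegaLimitPt_of_mem_omegaLimitPt {f : X → X} (hf : Continuous f)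
    {x p q : X} (hp : p ∈ omegaLimitPt f x) (hq : q ∈ omegaLimitPt f x) : ChainReach f p q :=
  chainReach_of_tendsto_omegaLimitPt hf hp tendsto_const_nhds tendsto_const_nhds fun _ => hq

lemma USCPoint.of_chainStable [CompactSpace X] {f : X → X} (hf : Continuous f) {x : X}
    (h : ChainStable f (omegaLimitPt f x)) : USCPoint f x := by
  intro U hU hxU
  by_contra! hcon
  have hex : ∀ j : ℕ, ∃ p q, dist x p ≤ 1 / ((j : ℝ) + 1) ∧ q ∈ omegaLimitPt f p ∧ q ∈ Uᶜ := by
    intro j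
    obtain ⟨p, hp, hpU⟩ := hcon (1 / ((j : ℝ) + 1)) Nat.one_div_pos_of_nat
    obtain ⟨q, hq, hqU⟩ := Set.not_subset.1 hpU
    exact ⟨p, q, hp, hq, hqU⟩
  choose xs qs hxs hqs hqU using hex
  obtain ⟨q, hq, φ, hφ, hlim⟩ := hU.isClosed_compl.isCompact.tendsto_subseq hqU
  have hxlim : Tendsto xs atTop (𝓝 x) := by
    rw [tendsto_iff_dist_tendsto_zero]
    exact squeeze_zero (fun _ => dist_nonneg) (fun j => by rw [dist_comm]; exact hxs j)
      tendsto_one_div_add_atTop_nhds_zero_nat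
  obtain ⟨y, hy⟩ := omegaLimitPt_nonempty f x
  exact hq (hxU (h y hy q (chainReach_of_tendsto_omegaLimitPt hf hy
    (hxlim.comp hφ.tendsto_atTop) hlim fun j => hqs (φ j))))

/-- A chain recurrent point reached from a shadowable upper semicontinuity point `x` of the
ω-limit set map lies in the ω-limit set of `x`. -/
lemma ShadowablePoint.mem_omegaLimitPt_of_chainReach [CompactSpace X] {f : X → X} {x z : X}
    (hx : ShadowablePoint f x) (husc : USCPoint f x) (hxz : ChainReach f x z)
    (hzz : ChainReach f z z) : z ∈ omegaLimitPt f x := by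
  by_contra hz
  obtain ⟨ε, hε, hball⟩ := Metric.nhds_basis_closedBall.mem_iff.1
    ((isClosed_omegaLimitPt f x).isOpen_compl.mem_nhds hz)
  obtain ⟨η, hη, hηU⟩ := husc (Metric.closedBall z ε)ᶜ Metric.isClosed_closedBall.isOpen_compl
    (Set.subset_compl_comm.1 hball)
  obtain ⟨δ, hδ, hshadow⟩ := hx (min ε η) (lt_min hε hη)
  obtain ⟨c, k, ⟨hk, hc⟩, hc0, hck⟩ := hxz δ hδ
  obtain ⟨d, m, ⟨hm, hd⟩, hd0, hdm⟩ := hzz δ hδ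
  have hloop : ∀ i, dist (f (d (i % m))) (d ((i + 1) % m)) ≤ δ := by
    intro i
    have hi := Nat.mod_lt i hm
    have hdi := hd (i % m) hi
    rcases Nat.lt_or_ge (i % m + 1) m with h | h
    · rwa [← Nat.mod_add_mod i m 1, Nat.mod_eq_of_lt h]
    · have h' : i % m + 1 = m := by omega
      rw [h', hdm, ← hd0] at hdi
      rwa [← Nat.mod_add_mod i m 1, h', Nat.mod_self]
  obtain ⟨w, hw⟩ := hshadow (fun i => if i < k then c i else d ((i - k) % m)) (by
    intro i
    rcases lt_trichotomy (i + 1) k with h | h | h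
    · simpa [h, show i < k by omega] using hc i (by omega)
    · have := hc i (by omega)
      rw [h, hck, ← hd0] at this
      simpa [h, show i < k by omega] using this
    · have := hloop (i - k)
      rw [show i - k + 1 = i + 1 - k by omega] at this
      simpa [show ¬ i < k by omega, show ¬ i + 1 < k by omega] using this)
    (by simp [show 0 < k by omega, hc0])
  have hwx : dist x w ≤ η := by
    have := hw 0
    simp only [show 0 < k by omega, if_true, hc0, Function.iterate_zero, id_eq] at this
    exact this.trans (min_le_right _ _)
  have hwz : ∀ j : ℕ, f^[k + j * m] w ∈ Metric.closedBall z ε := by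
    intro j
    have := hw (k + j * m)
    simp only [show ¬ k + j * m < k by omega, if_false, Nat.add_sub_cancel_left,
      Nat.mul_mod_left, hd0] at this
    rw [Metric.mem_closedBall']
    exact this.trans (min_le_left _ _)
  obtain ⟨q, hq, φ, hφ, hlim⟩ := Metric.isClosed_closedBall.isCompact.tendsto_subseq hwz
  refine hηU w hwx ⟨fun j => k + φ j * m, fun a b hab => ?_, hlim⟩ hq
  exact Nat.add_lt_add_left (Nat.mul_lt_mul_of_pos_right (hφ hab) hm) k

lemma ShadowablePoint.chainStable_of_uscPoint [CompactSpace X] {f : X → X} (hf : Continuous f)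
    {x : X} (hx : ShadowablePoint f x) (husc : USCPoint f x) :
    ChainStable f (omegaLimitPt f x) := by
  intro y hy z hyz
  have hxz : ChainReach f x z := (chainReach_of_mem_omegaLimitPt hy).trans hyz
  obtain ⟨q, hq⟩ := omegaLimitPt_nonempty f z
  have hzq : ChainReach f z q := chainReach_of_mem_omegaLimitPt hq
  have hqx : q ∈ omegaLimitPt f x := hx.mem_omegaLimitPt_of_chainReach husc (hxz.trans hzq)
    (chainReach_of_mem_omegaLimitPt_of_mem_omegaLimitPt hf hq hq)
  have hqy : ChainReach f q y := chainReach_of_mem_omegaLimitPt_of_mem_omegaLimitPt hf hqx hy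
  exact hx.mem_omegaLimitPt_of_chainReach husc hxz (hzq.trans (hqy.trans hyz))

theorem stmt3 [CompactSpace X] (f : X → X) (hf : Continuous f) (x : X)
    (hx : ShadowablePoint f x) :
    USCPoint f x ↔ ChainStable f (omegaLimitPt f x) := by
  exact ⟨hx.chainStable_of_uscPoint hf, USCPoint.of_chainStable hf⟩
end
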